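/- There exists an isometric embedding F : [0,1] → L¹[0,1] that is nowhere differentiable, such that for each t ∈ [0,1] the representative F_t : [0,1] → ℝ is infinitely differentiable. -/

import Mathlib

open MeasureTheory Set

noncomputable abbrev mu01 : Measure ℝ := volume.restrict (Icc (0:ℝ) 1)

def HasDerivAtWithin01 {E : Type*} [NormedAddCommGroup E] [NormedSpace ℝ E]
    (F : ℝ → E) (D : E) (t₀ : ℝ) : Prop :=
  ∀ ε > (0:ℝ), ∃ δ > (0:ℝ), ∀ h : ℝ, t₀ + h ∈ Icc (0:ℝ) 1 → |h| < δ →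
    ‖F (t₀ + h) - F t₀ - h • D‖ ≤ ε * |h|

noncomputable section

/-- All derivatives of `f` are bounded geometrically: `|f⁽ᵏ⁾| ≤ C * R ^ k`. -/
structure GeometricDerivBound (C R : ℝ) (f : ℝ → ℝ) : Prop where
  contDiff : ContDiff ℝ (⊤ : ℕ∞) f
  norm_le : ∀ k x, ‖iteratedFDeriv ℝ k f x‖ ≤ C * R ^ k

namespace GeometricDerivBound

variable {C C' R R' : ℝ} {f g : ℝ → ℝ}

theorem mul (hf : GeometricDerivBound C R f) (hg : GeometricDerivBound C' R' g)
    (hC : 0 ≤ C) (hR : 0 ≤ R) :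
    GeometricDerivBound (C * C') (R + R') (fun x => f x * g x) := by
  refine ⟨hf.contDiff.mul hg.contDiff, fun k x => ?_⟩
  refine (norm_iteratedFDeriv_mul_le hf.contDiff hg.contDiff x
    (by exact_mod_cast le_top)).trans ?_
  rw [add_pow, Finset.mul_sum]
  refine Finset.sum_le_sum fun i _ => ?_
  calc (k.choose i : ℝ) * ‖iteratedFDeriv ℝ i f x‖ * ‖iteratedFDeriv ℝ (k - i) g x‖
      ≤ (k.choose i : ℝ) * (C * R ^ i) * (C' * R' ^ (k - i)) := by
        gcongr
        · exact hf.norm_le i x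
        · exact hg.norm_le _ x
    _ = _ := by ring

theorem add (hf : GeometricDerivBound C R f) (hg : GeometricDerivBound C' R g) :
    GeometricDerivBound (C + C') R (fun x => f x + g x) := by
  refine ⟨hf.contDiff.add hg.contDiff, fun k x => ?_⟩
  have h := iteratedFDeriv_add_apply (𝕜 := ℝ) (i := k) (x := x)
    (hf.contDiff.of_le (by exact_mod_cast le_top)).contDiffAt
    (hg.contDiff.of_le (by exact_mod_cast le_top)).contDiffAt
  change ‖iteratedFDeriv ℝ k (f + g) x‖ ≤ _
  rw [h, add_mul]
  exact (norm_add_le _ _).trans (add_le_add (hf.norm_le k x) (hg.norm_le k x))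

theorem const (c : ℝ) (hR : 0 ≤ R) : GeometricDerivBound |c| R (fun _ => c) := by
  refine ⟨contDiff_const, fun k x => ?_⟩
  rcases Nat.eq_zero_or_pos k with rfl | hk
  · simp
  · rw [iteratedFDeriv_const_of_ne hk.ne']
    simp only [Pi.zero_apply, norm_zero]
    positivity

theorem const_mul (c : ℝ) (hf : GeometricDerivBound C R f) :
    GeometricDerivBound (|c| * C) R (fun x => c * f x) := by
  simpa using (const (R := 0) c le_rfl).mul hf (abs_nonneg c) le_rfl

theorem mono (hf : GeometricDerivBound C R f) (h : C ≤ C') (hR : 0 ≤ R) :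
    GeometricDerivBound C' R f :=
  ⟨hf.contDiff, fun k x => (hf.norm_le k x).trans (by gcongr)⟩

theorem cos {c : ℝ} (hc : 0 ≤ c) : GeometricDerivBound 1 c (fun x => Real.cos (c * x)) := by
  refine ⟨Real.contDiff_cos.comp (contDiff_const.mul contDiff_id), fun k x => ?_⟩
  rw [norm_iteratedFDeriv_eq_norm_iteratedDeriv,
    iteratedDeriv_comp_const_mul Real.contDiff_cos c]
  simp only [norm_mul, norm_pow, Real.norm_eq_abs, abs_of_nonneg hc, one_mul]
  exact mul_le_of_le_one_right (by positivity) (Real.abs_iteratedDeriv_cos_le_one k _)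

end GeometricDerivBound

/-- The cosine of frequency `2 ^ n`. -/
def wave (n : ℕ) (x : ℝ) : ℝ := Real.cos (2 * Real.pi * 2 ^ n * x)

/-- The Riesz product with coefficients `ε` on the dyadic frequencies below `2 ^ n`. -/
def riesz (ε : ℕ → ℝ) (n : ℕ) (x : ℝ) : ℝ := ∏ k ∈ Finset.range n, (1 + ε k * wave k x)

theorem riesz_succ (ε : ℕ → ℝ) (n : ℕ) (x : ℝ) :
    riesz ε (n + 1) x = riesz ε n x * (1 + ε n * wave n x) :=
  Finset.prod_range_succ _ _

theorem abs_wave_le_one (n : ℕ) (x : ℝ) : |wave n x| ≤ 1 := Real.abs_cos_le_one _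

theorem riesz_nonneg {ε : ℕ → ℝ} (hε : ∀ k, |ε k| ≤ 1) (n : ℕ) (x : ℝ) : 0 ≤ riesz ε n x := by
  refine Finset.prod_nonneg fun k _ => ?_
  have h : |ε k * wave k x| ≤ 1 := by
    rw [abs_mul]
    exact mul_le_one₀ (hε k) (abs_nonneg _) (abs_wave_le_one k x)
  linarith [(abs_le.mp h).1]

theorem geometricDerivBound_wave (n : ℕ) :
    GeometricDerivBound 1 (2 * Real.pi * 2 ^ n) (wave n) :=
  GeometricDerivBound.cos (by positivity)

theorem geometricDerivBound_riesz {ε : ℕ → ℝ} (hε : ∀ k, |ε k| ≤ 1) (n : ℕ) :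
    GeometricDerivBound (2 ^ n) (2 * Real.pi * 2 ^ n) (riesz ε n) := by
  induction n with
  | zero =>
    have h := GeometricDerivBound.const (R := 2 * Real.pi) 1 (by positivity)
    have h' : riesz ε 0 = fun _ => 1 := by ext x; simp [riesz]
    simpa [h'] using h
  | succ n ih =>
    have h1 : GeometricDerivBound 2 (2 * Real.pi * 2 ^ n) (fun x => 1 + ε n * wave n x) := by
      refine ((GeometricDerivBound.const 1 (by positivity)).add
        ((geometricDerivBound_wave n).const_mul (ε n))).mono ?_ (by positivity)
      have := hε n
      rw [abs_one]
      linarith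
    have h := ih.mul h1 (by positivity) (by positivity)
    have h' : riesz ε (n + 1) = fun x => riesz ε n x * (1 + ε n * wave n x) :=
      funext fun x => riesz_succ ε n x
    rw [h']
    convert h using 1 <;> ring

theorem geometricDerivBound_wave_mul_riesz {ε : ℕ → ℝ} (hε : ∀ k, |ε k| ≤ 1) (n : ℕ) :
    GeometricDerivBound (2 ^ n) (4 * Real.pi * 2 ^ n) (fun x => wave n x * riesz ε n x) := by
  convert (geometricDerivBound_wave n).mul (geometricDerivBound_riesz hε n) zero_le_one
    (by positivity) using 1 <;> ring

theorem continuous_wave (n : ℕ) : Continuous (wave n) :=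
  (geometricDerivBound_wave n).contDiff.continuous

theorem continuous_riesz (ε : ℕ → ℝ) (n : ℕ) : Continuous (riesz ε n) :=
  continuous_finsetProd _ fun k _ => continuous_const.add (continuous_const.mul (continuous_wave k))

theorem integral_cos_two_pi_nat_mul {j : ℕ} (hj : j ≠ 0) :
    ∫ x in (0:ℝ)..1, Real.cos (2 * Real.pi * j * x) = 0 := by
  have hc : 2 * Real.pi * (j : ℝ) ≠ 0 := by positivity
  rw [intervalIntegral.integral_comp_mul_left (fun x => Real.cos x) hc, integral_cos]
  have : Real.sin (2 * Real.pi * j) = 0 := by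
    rw [show 2 * Real.pi * (j : ℝ) = ((2 * j : ℕ) : ℝ) * Real.pi by push_cast; ring]
    exact Real.sin_nat_mul_pi _
  simp [this]

theorem wave_mul_cos {n j : ℕ} (hj : 2 ^ n ≤ j) (x : ℝ) :
    wave n x * Real.cos (2 * Real.pi * j * x) =
      (Real.cos (2 * Real.pi * (j + 2 ^ n : ℕ) * x) +
        Real.cos (2 * Real.pi * (j - 2 ^ n : ℕ) * x)) / 2 := by
  rw [wave, show 2 * Real.pi * ((j + 2 ^ n : ℕ) : ℝ) * x =
    2 * Real.pi * j * x + 2 * Real.pi * 2 ^ n * x by push_cast; ring,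
    show 2 * Real.pi * ((j - 2 ^ n : ℕ) : ℝ) * x =
    2 * Real.pi * j * x - 2 * Real.pi * 2 ^ n * x by push_cast [hj]; ring,
    Real.cos_add, Real.cos_sub]
  ring

theorem integral_riesz_mul_cos (ε : ℕ → ℝ) (n : ℕ) :
    ∀ j : ℕ, 2 ^ n ≤ j → ∫ x in (0:ℝ)..1, riesz ε n x * Real.cos (2 * Real.pi * j * x) = 0 := by
  induction n with
  | zero =>
    intro j hj
    simpa [riesz] using integral_cos_two_pi_nat_mul (j := j) (by simp at hj; omega)
  | succ n ih =>
    intro j hj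
    rw [pow_succ] at hj
    have hc : ∀ i : ℕ, IntervalIntegrable
        (fun x => riesz ε n x * Real.cos (2 * Real.pi * i * x)) volume 0 1 := fun i =>
      ((continuous_riesz ε n).mul (by fun_prop)).intervalIntegrable _ _
    have h : ∀ x, riesz ε (n + 1) x * Real.cos (2 * Real.pi * j * x) =
        riesz ε n x * Real.cos (2 * Real.pi * j * x) +
        (ε n / 2) * (riesz ε n x * Real.cos (2 * Real.pi * (j + 2 ^ n : ℕ) * x) +
          riesz ε n x * Real.cos (2 * Real.pi * (j - 2 ^ n : ℕ) * x)) := fun x => by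
      rw [riesz_succ]
      linear_combination (riesz ε n x * ε n) * wave_mul_cos (n := n) (j := j) (by omega) x
    simp_rw [h]
    rw [intervalIntegral.integral_add (hc j) (((hc _).add (hc _)).const_mul _),
      intervalIntegral.integral_const_mul, intervalIntegral.integral_add (hc _) (hc _),
      ih j (by omega), ih _ (by omega), ih _ (by omega)]
    simp

theorem integral_wave_mul_riesz (ε : ℕ → ℝ) (n : ℕ) :
    ∫ x in (0:ℝ)..1, wave n x * riesz ε n x = 0 := by
  simpa [wave, mul_comm] using integral_riesz_mul_cos ε n (2 ^ n) le_rfl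

theorem integral_riesz (ε : ℕ → ℝ) (n : ℕ) : ∫ x in (0:ℝ)..1, riesz ε n x = 1 := by
  induction n with
  | zero => simp [riesz]
  | succ n ih =>
    have h : ∀ x, riesz ε (n + 1) x = riesz ε n x + ε n * (wave n x * riesz ε n x) :=
      fun x => by rw [riesz_succ]; ring
    simp_rw [h]
    have hr := continuous_riesz ε n
    have hw := continuous_wave n
    rw [intervalIntegral.integral_add, intervalIntegral.integral_const_mul,
      integral_wave_mul_riesz, ih]
    · simp
    · exact Continuous.intervalIntegrable (by fun_prop) _ _
    · exact Continuous.intervalIntegrable (by fun_prop) _ _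

theorem half_le_integral_abs_wave_mul_riesz {ε : ℕ → ℝ} (hε : ∀ k, |ε k| ≤ 1) (n : ℕ) :
    1 / 2 ≤ ∫ x in (0:ℝ)..1, |wave n x * riesz ε n x| := by
  have hr := continuous_riesz ε n
  have hw := continuous_wave n
  have h : ∫ x in (0:ℝ)..1, wave n x ^ 2 * riesz ε n x = 1 / 2 := by
    have h1 : ∀ x, wave n x ^ 2 * riesz ε n x = (1 / 2) * riesz ε n x +
        (1 / 2) * (riesz ε n x * Real.cos (2 * Real.pi * (2 ^ (n + 1) : ℕ) * x)) := fun x => by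
      rw [show 2 * Real.pi * ((2 ^ (n + 1) : ℕ) : ℝ) * x = 2 * (2 * Real.pi * 2 ^ n * x) by
        push_cast; ring, Real.cos_two_mul, wave]
      ring
    simp_rw [h1]
    rw [intervalIntegral.integral_add, intervalIntegral.integral_const_mul,
      intervalIntegral.integral_const_mul, integral_riesz,
      integral_riesz_mul_cos ε n _ (Nat.pow_le_pow_right two_pos n.le_succ)]
    · simp
    · exact Continuous.intervalIntegrable (by fun_prop) _ _
    · exact Continuous.intervalIntegrable (by fun_prop) _ _
  rw [← h]
  refine intervalIntegral.integral_mono_on zero_le_one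
    (Continuous.intervalIntegrable (by fun_prop) _ _)
    (Continuous.intervalIntegrable (by fun_prop) _ _) fun x _ => ?_
  rw [abs_mul, abs_of_nonneg (riesz_nonneg hε n x), ← sq_abs]
  gcongr
  · exact riesz_nonneg hε n x
  · exact pow_le_of_le_one (abs_nonneg _) (abs_wave_le_one n x) two_ne_zero

/-- The number of periods of the `n`-th tent function in the unit interval. -/
def periodCount (n : ℕ) : ℕ := 2 ^ n * n.factorial

theorem periodCount_pos (n : ℕ) : 0 < periodCount n := by
  unfold periodCount
  positivity

theorem periodCount_succ (n : ℕ) : periodCount (n + 1) = 2 * periodCount n * (n + 1) := by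
  rw [periodCount, periodCount, Nat.factorial_succ]
  ring

theorem two_mul_periodCount_dvd {k n : ℕ} (h : k < n) : 2 * periodCount k ∣ periodCount n := by
  induction n, h using Nat.le_induction with
  | base => exact ⟨k + 1, periodCount_succ k⟩
  | succ n _ ih => exact ih.trans ⟨2 * (n + 1), by rw [periodCount_succ]; ring⟩

/-- The distance from `t` to the nearest multiple of `1 / periodCount n`. -/
def tent (n : ℕ) (t : ℝ) : ℝ :=
  min (Int.fract (periodCount n * t)) (1 - Int.fract (periodCount n * t)) / periodCount n

/-- The right derivative of `tent n`. -/
def tentSlope (n : ℕ) (t : ℝ) : ℝ := if Even ⌊2 * periodCount n * t⌋ then 1 else -1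

theorem abs_tentSlope_le_one (n : ℕ) (t : ℝ) : |tentSlope n t| ≤ 1 := by
  unfold tentSlope
  split_ifs <;> simp

theorem abs_tent_le (n : ℕ) (t : ℝ) : |tent n t| ≤ 1 / periodCount n := by
  have h0 := Int.fract_nonneg (periodCount n * t)
  have h1 := Int.fract_lt_one (periodCount n * t)
  rw [tent, abs_div, Nat.abs_cast]
  gcongr
  rw [abs_of_nonneg (le_min h0 (by linarith))]
  exact (min_le_left _ _).trans h1.le

theorem tent_eq_zero {n : ℕ} {t : ℝ} {i : ℤ} (h : periodCount n * t = i) : tent n t = 0 := by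
  simp [tent, h]

theorem tent_eq_left {n : ℕ} {t : ℝ} {i : ℤ} (h : i ≤ periodCount n * t)
    (h' : periodCount n * t ≤ i + 1 / 2) : tent n t = t - i / periodCount n := by
  have hK : (periodCount n : ℝ) ≠ 0 := by exact_mod_cast (periodCount_pos n).ne'
  have hf : ⌊periodCount n * t⌋ = i := Int.floor_eq_iff.mpr ⟨h, by linarith⟩
  rw [tent, Int.fract, hf, min_eq_left (by linarith)]
  field_simp

theorem tent_eq_right {n : ℕ} {t : ℝ} {i : ℤ} (h : i + 1 / 2 ≤ periodCount n * t)
    (h' : periodCount n * t ≤ i + 1) : tent n t = (i + 1) / periodCount n - t := by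
  have hK : (periodCount n : ℝ) ≠ 0 := by exact_mod_cast (periodCount_pos n).ne'
  rcases h'.eq_or_lt with h1 | h1
  · rw [tent_eq_zero (i := i + 1) (by exact_mod_cast h1), ← h1]
    field_simp
    ring
  · have hf : ⌊periodCount n * t⌋ = i := Int.floor_eq_iff.mpr ⟨by linarith, h1⟩
    rw [tent, Int.fract, hf, min_eq_right (by linarith)]
    field_simp
    ring

theorem tentSlope_eq {k n : ℕ} (hkn : k < n) {t : ℝ} {j : ℤ} (h : ⌊periodCount n * t⌋ = j) :
    tentSlope k t = tentSlope k (j / periodCount n) := by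
  obtain ⟨q, hq⟩ := two_mul_periodCount_dvd hkn
  have hn := periodCount_pos n
  have hq0 : (q : ℝ) ≠ 0 := by
    rintro h0
    simp only [Nat.cast_eq_zero] at h0
    simp [h0] at hq
    omega
  have hqR : (periodCount n : ℝ) = 2 * periodCount k * q := by exact_mod_cast hq
  have hk : (periodCount k : ℝ) ≠ 0 := by exact_mod_cast (periodCount_pos k).ne'
  have key : ∀ u : ℝ, ⌊2 * periodCount k * u⌋ = ⌊periodCount n * u⌋ / (q : ℤ) := fun u => by
    rw [← Int.floor_div_natCast, hqR]
    congr 1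
    field_simp
  have h2 : ⌊(periodCount n : ℝ) * (j / periodCount n)⌋ = j := by
    rw [mul_div_cancel₀ _ (by positivity), Int.floor_intCast]
  rw [tentSlope, tentSlope, key, key, h, h2]

/-- The `n`-th term of the series defining the embedding. -/
def correction (n : ℕ) (t x : ℝ) : ℝ :=
  tent n t * (wave n x * riesz (fun k => tentSlope k t) n x)

/-- The partial sums of the embedding. -/
def partialEmbedding (n : ℕ) (t x : ℝ) : ℝ := t + ∑ k ∈ Finset.range n, correction k t x

theorem correction_eq {n : ℕ} {t : ℝ} {i : ℤ} (h : i ≤ periodCount n * t)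
    (h' : periodCount n * t ≤ i + 1) (x : ℝ) :
    correction n t x =
      tent n t * (wave n x * riesz (fun k => tentSlope k (i / periodCount n)) n x) := by
  rcases h'.eq_or_lt with h1 | h1
  · rw [correction, tent_eq_zero (i := i + 1) (by exact_mod_cast h1)]
    simp
  · have hf : ⌊periodCount n * t⌋ = i := Int.floor_eq_iff.mpr ⟨h, h1⟩
    rw [correction, riesz, riesz, Finset.prod_congr rfl fun k hk => ?_]
    rw [tentSlope_eq (Finset.mem_range.mp hk) hf]

theorem partialEmbedding_affine (n : ℕ) : ∀ (j : ℤ) (t : ℝ), j ≤ periodCount n * t →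
    periodCount n * t ≤ j + 1 → ∀ x, partialEmbedding n t x =
      partialEmbedding n (j / periodCount n) x +
        (t - j / periodCount n) * riesz (fun k => tentSlope k (j / periodCount n)) n x := by
  induction n with
  | zero =>
    intro j t _ _ x
    simp [partialEmbedding, riesz]
  | succ n ih =>
    intro j t hjt htj x
    have hK : (0 : ℝ) < periodCount n := by exact_mod_cast periodCount_pos n
    have hKs : (periodCount (n + 1) : ℝ) = 2 * periodCount n * (n + 1) := by
      exact_mod_cast periodCount_succ n
    have hn : (0 : ℝ) < n + 1 := by positivity
    rw [hKs] at hjt htj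
    set s : ℝ := j / periodCount (n + 1) with hs
    have hsj : 2 * periodCount n * s = j / (n + 1) := by
      rw [hs, hKs]
      field_simp
    obtain ⟨m, hm⟩ : ∃ m, ⌊2 * periodCount n * s⌋ = m := ⟨_, rfl⟩
    have hm0 : (m : ℝ) ≤ 2 * periodCount n * s := (Int.floor_eq_iff.mp hm).1
    have hm1 : 2 * periodCount n * s < m + 1 := (Int.floor_eq_iff.mp hm).2
    have hst : s ≤ t := by
      rw [hs, hKs, div_le_iff₀ (by positivity)]
      linarith
    have hm2 : 2 * periodCount n * t ≤ m + 1 := by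
      rw [hsj, div_lt_iff₀ hn] at hm1
      have hint : j + 1 ≤ (m + 1) * (n + 1) := by exact_mod_cast hm1
      have hreal : (j : ℝ) + 1 ≤ (m + 1) * (n + 1) := by exact_mod_cast hint
      exact le_of_mul_le_mul_right (by linarith) hn
    have hms : 2 * periodCount n * s ≤ 2 * periodCount n * t := by gcongr
    obtain ⟨i, hi0, hi1, hi2, hslope⟩ : ∃ i : ℤ, i ≤ periodCount n * s ∧
        periodCount n * s < i + 1 ∧ periodCount n * t ≤ i + 1 ∧
        tent n t - tent n s = tentSlope n s * (t - s) := by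
      rcases Int.even_or_odd' m with ⟨i, rfl | rfl⟩
      · push_cast at hm0 hm1 hm2
        refine ⟨i, by linarith, by linarith, by linarith, ?_⟩
        rw [tent_eq_left (i := i) (by linarith) (by linarith),
          tent_eq_left (i := i) (by linarith) (by linarith), tentSlope, hm, if_pos (by simp)]
        ring
      · push_cast at hm0 hm1 hm2
        refine ⟨i, by linarith, by linarith, by linarith, ?_⟩
        rw [tent_eq_right (i := i) (by linarith) (by linarith),
          tent_eq_right (i := i) (by linarith) (by linarith), tentSlope, hm,
          if_neg (by simp [parity_simps])]
        ring
    have hKst : (periodCount n : ℝ) * s ≤ periodCount n * t := by gcongr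
    have hρ : riesz (fun k => tentSlope k s) n x =
        riesz (fun k => tentSlope k (i / periodCount n)) n x :=
      Finset.prod_congr rfl fun k hk => by
        beta_reduce
        rw [tentSlope_eq (Finset.mem_range.mp hk) (Int.floor_eq_iff.mpr ⟨hi0, hi1⟩)]
    have ht := ih i t (hi0.trans hKst) hi2 x
    have hs' := ih i s hi0 hi1.le x
    have hsum : ∀ u, partialEmbedding (n + 1) u x = partialEmbedding n u x + correction n u x :=
      fun u => by rw [partialEmbedding, Finset.sum_range_succ, ← add_assoc, partialEmbedding]
    rw [hsum, hsum, riesz_succ, correction_eq (hi0.trans hKst) hi2, correction_eq hi0 hi1.le, hρ]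
    linear_combination ht - hs' +
      wave n x * riesz (fun k => tentSlope k (i / periodCount n)) n x * hslope

theorem partialEmbedding_mono (n : ℕ) (x : ℝ) : Monotone fun t => partialEmbedding n t x := by
  have hK : (0 : ℝ) < periodCount n := by exact_mod_cast periodCount_pos n
  have hpiece : ∀ (j : ℤ) (s t : ℝ), j ≤ periodCount n * s → s ≤ t →
      periodCount n * t ≤ j + 1 → partialEmbedding n s x ≤ partialEmbedding n t x := by
    intro j s t hs hst ht
    have h : (periodCount n : ℝ) * s ≤ periodCount n * t := by gcongr
    rw [partialEmbedding_affine n j s hs (h.trans ht) x,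
      partialEmbedding_affine n j t (hs.trans h) ht x]
    gcongr
    exact riesz_nonneg (fun k => abs_tentSlope_le_one k _) n x
  have hgrid : Monotone fun j : ℤ => partialEmbedding n (j / periodCount n) x := by
    refine monotone_int_of_le_succ fun j => hpiece j _ _ ?_ ?_ ?_
    · rw [mul_div_cancel₀ _ hK.ne']
    · gcongr
      simp
    · rw [mul_div_cancel₀ _ hK.ne']
      simp
  intro s t hst
  have hs0 := Int.floor_le (periodCount n * s)
  have hs1 := (Int.lt_floor_add_one (periodCount n * s)).le
  have ht0 := Int.floor_le (periodCount n * t)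
  have ht1 := (Int.lt_floor_add_one (periodCount n * t)).le
  have hfl : ⌊periodCount n * s⌋ ≤ ⌊periodCount n * t⌋ := Int.floor_mono (by gcongr)
  rcases hfl.eq_or_lt with h | h
  · exact hpiece _ s t hs0 hst (by rw [h]; exact ht1)
  · calc partialEmbedding n s x
        ≤ partialEmbedding n ((⌊periodCount n * s⌋ + 1 : ℤ) / periodCount n) x := by
          refine hpiece _ _ _ hs0 ?_ ?_
          · rw [le_div_iff₀ hK]
            push_cast
            linarith
          · rw [mul_div_cancel₀ _ hK.ne']
            simp
      _ ≤ partialEmbedding n (⌊periodCount n * t⌋ / periodCount n) x := hgrid h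
      _ ≤ partialEmbedding n t x := by
          refine hpiece _ _ _ ?_ ?_ ht1
          · rw [mul_div_cancel₀ _ hK.ne']
          · rw [div_le_iff₀ hK]
            linarith

/-- A representative of the value at `t` of the embedding. -/
def smoothEmbedding (t x : ℝ) : ℝ := t + ∑' k, correction k t x

theorem geometricDerivBound_correction (n : ℕ) (t : ℝ) :
    GeometricDerivBound (1 / n.factorial) (4 * Real.pi * 2 ^ n) (correction n t) := by
  refine ((geometricDerivBound_wave_mul_riesz
    (fun k => abs_tentSlope_le_one k t) n).const_mul (tent n t)).mono ?_ (by positivity)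
  have h : (1 : ℝ) / n.factorial = 1 / periodCount n * 2 ^ n := by
    rw [periodCount]
    push_cast
    field_simp
  rw [h]
  gcongr
  exact abs_tent_le n t

theorem continuous_correction (n : ℕ) (t : ℝ) : Continuous (correction n t) :=
  (geometricDerivBound_correction n t).contDiff.continuous

theorem abs_correction_le (n : ℕ) (t x : ℝ) : |correction n t x| ≤ 1 / n.factorial := by
  simpa using (geometricDerivBound_correction n t).norm_le 0 x

theorem summable_one_div_factorial : Summable fun n : ℕ => (1 : ℝ) / n.factorial := by
  simpa using Real.summable_pow_div_factorial 1

theorem summable_correction (t x : ℝ) : Summable fun n => correction n t x :=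
  .of_norm_bounded summable_one_div_factorial fun n => abs_correction_le n t x

theorem contDiff_smoothEmbedding (t : ℝ) : ContDiff ℝ (⊤ : ℕ∞) (smoothEmbedding t) := by
  refine contDiff_const.add (contDiff_tsum
    (v := fun m n => 1 / n.factorial * (4 * Real.pi * 2 ^ n) ^ m)
    (fun n => (geometricDerivBound_correction n t).contDiff) (fun m _ => ?_)
    fun m n x _ => (geometricDerivBound_correction n t).norm_le m x)
  refine ((Real.summable_pow_div_factorial ((2 : ℝ) ^ m)).mul_left ((4 * Real.pi) ^ m)).congr
    fun n => ?_
  rw [mul_pow _ ((2 : ℝ) ^ n), ← pow_mul, ← pow_mul, mul_comm n m]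
  ring

theorem smoothEmbedding_mono (x : ℝ) : Monotone fun t => smoothEmbedding t x := by
  have h : ∀ t, Filter.Tendsto (fun n => partialEmbedding n t x) Filter.atTop
      (nhds (smoothEmbedding t x)) := fun t =>
    (summable_correction t x).hasSum.tendsto_sum_nat.const_add t
  exact fun s t hst => le_of_tendsto_of_tendsto' (h s) (h t)
    fun n => partialEmbedding_mono n x hst

theorem integral_smoothEmbedding (t : ℝ) : ∫ x in (0:ℝ)..1, smoothEmbedding t x = t := by
  have hint : ∀ n, ∫ x in (0:ℝ)..1, correction n t x = 0 := fun n => by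
    simp only [correction, intervalIntegral.integral_const_mul, integral_wave_mul_riesz, mul_zero]
  have hsum : HasSum (fun n => ∫ x in (0:ℝ)..1, correction n t x)
      (∫ x in (0:ℝ)..1, ∑' n, correction n t x) := by
    refine intervalIntegral.hasSum_integral_of_dominated_convergence
      (fun n _ => 1 / n.factorial)
      (fun n => (continuous_correction n t).aestronglyMeasurable)
      (fun n => .of_forall fun x _ => abs_correction_le n t x)
      (.of_forall fun x _ => summable_one_div_factorial) (by simp)
      (.of_forall fun x _ => (summable_correction t x).hasSum)
  simp only [hint] at hsum
  have hzero := hsum.unique hasSum_zero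
  have hcont : Continuous fun x => ∑' n, correction n t x := by
    exact ((contDiff_smoothEmbedding t).continuous.sub (continuous_const (y := t))).congr
      fun x => by simp [smoothEmbedding]
  simp only [smoothEmbedding]
  rw [intervalIntegral.integral_add (by simp) (hcont.intervalIntegrable _ _), hzero]
  simp

theorem smoothEmbedding_eq_of_grid {n : ℕ} {t : ℝ} {i : ℤ} (h : 2 * periodCount n * t = i)
    (x : ℝ) : smoothEmbedding t x = partialEmbedding n t x + correction n t x := by
  have h' : smoothEmbedding t x = partialEmbedding (n + 1) t x := by
    rw [smoothEmbedding, partialEmbedding, tsum_eq_sum fun k hk => ?_]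
    obtain ⟨q, hq⟩ := two_mul_periodCount_dvd (show n < k by simpa using hk)
    have hq' : (periodCount k : ℝ) * t = (i * q : ℤ) := by
      rw [hq]
      push_cast
      linear_combination (q : ℝ) * h
    rw [correction, tent_eq_zero hq', zero_mul]
  rw [h', partialEmbedding, Finset.sum_range_succ, ← add_assoc, partialEmbedding]

theorem smoothEmbedding_second_difference (n : ℕ) (i : ℤ) (x : ℝ) :
    smoothEmbedding (i / periodCount n) x -
        2 * smoothEmbedding ((i + 1 / 2) / periodCount n) x +
        smoothEmbedding ((i + 1) / periodCount n) x =
      -(1 / periodCount n) *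
        (wave n x * riesz (fun k => tentSlope k (i / periodCount n)) n x) := by
  have hK : (0 : ℝ) < periodCount n := by exact_mod_cast periodCount_pos n
  have h0 : (periodCount n : ℝ) * (i / periodCount n) = i := by field_simp
  have h1 : (periodCount n : ℝ) * ((i + 1 / 2) / periodCount n) = i + 1 / 2 := by field_simp
  have h2 : (periodCount n : ℝ) * ((i + 1) / periodCount n) = i + 1 := by field_simp
  rw [smoothEmbedding_eq_of_grid (n := n) (i := 2 * i) (by push_cast; linarith),
    smoothEmbedding_eq_of_grid (n := n) (i := 2 * i + 1) (by push_cast; linarith),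
    smoothEmbedding_eq_of_grid (n := n) (i := 2 * i + 2) (by push_cast; linarith),
    correction_eq (t := i / periodCount n) (i := i) (by linarith) (by linarith),
    correction_eq (t := (i + 1 / 2) / periodCount n) (i := i) (by linarith) (by linarith),
    correction_eq (t := (i + 1) / periodCount n) (i := i) (by linarith) (by linarith),
    tent_eq_left (t := i / periodCount n) (i := i) (by linarith) (by linarith),
    tent_eq_left (t := (i + 1 / 2) / periodCount n) (i := i) (by linarith) (by linarith),
    tent_eq_right (t := (i + 1) / periodCount n) (i := i) (by linarith) (by linarith),
    partialEmbedding_affine n i ((i + 1 / 2) / periodCount n) (by linarith) (by linarith),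
    partialEmbedding_affine n i ((i + 1) / periodCount n) (by linarith) (by linarith)]
  field_simp
  ring

theorem integrable_mu01 {f : ℝ → ℝ} (hf : Continuous f) : Integrable f mu01 :=
  hf.continuousOn.integrableOn_compact isCompact_Icc

theorem norm_toL1_mu01 {f : ℝ → ℝ} (hf : Continuous f) :
    ‖(integrable_mu01 hf).toL1 f‖ = ∫ x in (0:ℝ)..1, |f x| := by
  rw [L1.norm_of_fun_eq_integral_norm, intervalIntegral.integral_of_le zero_le_one,
    integral_Icc_eq_integral_Ioc]
  rfl

theorem continuous_smoothEmbedding (t : ℝ) : Continuous (smoothEmbedding t) :=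
  (contDiff_smoothEmbedding t).continuous

/-- The nowhere differentiable isometric embedding into `L¹[0,1]`. -/
def smoothValuedIsometry (t : ℝ) : Lp ℝ 1 mu01 :=
  (integrable_mu01 (continuous_smoothEmbedding t)).toL1 _

theorem norm_smoothValuedIsometry_sub (s t : ℝ) :
    ‖smoothValuedIsometry t - smoothValuedIsometry s‖ = |t - s| := by
  wlog hst : s ≤ t generalizing s t
  · rw [norm_sub_rev, abs_sub_comm]
    exact this t s (le_of_not_ge hst)
  have hs := continuous_smoothEmbedding s
  have ht := continuous_smoothEmbedding t
  rw [smoothValuedIsometry, smoothValuedIsometry, ← Integrable.toL1_sub,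
    norm_toL1_mu01 (ht.sub hs), abs_of_nonneg (sub_nonneg.mpr hst)]
  have h : ∀ x, |(smoothEmbedding t - smoothEmbedding s) x| =
      smoothEmbedding t x - smoothEmbedding s x := fun x =>
    abs_of_nonneg (sub_nonneg.mpr (smoothEmbedding_mono x hst))
  simp only [h]
  rw [intervalIntegral.integral_sub (ht.intervalIntegrable _ _) (hs.intervalIntegrable _ _),
    integral_smoothEmbedding, integral_smoothEmbedding]

theorem norm_smoothValuedIsometry_second_difference (n : ℕ) (i : ℤ) :
    1 / (2 * periodCount n) ≤
      ‖smoothValuedIsometry (i / periodCount n) -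
        (2 : ℝ) • smoothValuedIsometry ((i + 1 / 2) / periodCount n) +
        smoothValuedIsometry ((i + 1) / periodCount n)‖ := by
  have h0 := continuous_smoothEmbedding (i / periodCount n)
  have h1 : Continuous fun x => (2 : ℝ) • smoothEmbedding ((i + 1 / 2) / periodCount n) x :=
    continuous_const.mul (continuous_smoothEmbedding ((i + 1 / 2) / periodCount n))
  have h2 := continuous_smoothEmbedding ((i + 1) / periodCount n)
  rw [smoothValuedIsometry, smoothValuedIsometry, smoothValuedIsometry, ← Integrable.toL1_smul,
    ← Integrable.toL1_sub, ← Integrable.toL1_add, norm_toL1_mu01 ((h0.sub h1).add h2)]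
  simp only [Pi.add_apply, Pi.sub_apply, smul_eq_mul, smoothEmbedding_second_difference]
  simp only [abs_mul, abs_neg, intervalIntegral.integral_const_mul]
  have h := half_le_integral_abs_wave_mul_riesz
    (fun k => abs_tentSlope_le_one k (i / periodCount n)) n
  simp only [abs_mul] at h
  calc (1 : ℝ) / (2 * periodCount n) = 1 / periodCount n * (1 / 2) := by ring
    _ ≤ _ := by
      rw [abs_of_nonneg (by positivity : (0 : ℝ) ≤ 1 / periodCount n)]
      gcongr

theorem exists_periodCount_gt (r : ℝ) : ∃ n, r < periodCount n := by
  obtain ⟨n, hn⟩ := exists_nat_gt r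
  refine ⟨n, hn.trans_le ?_⟩
  exact_mod_cast n.self_le_factorial.trans (Nat.le_mul_of_pos_left _ (by positivity))

theorem exists_int_mem_Icc_unit {N : ℕ} (hN : 0 < N) {t : ℝ} (ht : t ∈ Icc (0:ℝ) 1) :
    ∃ i : ℤ, 0 ≤ i ∧ i + 1 ≤ (N : ℤ) ∧ i ≤ N * t ∧ N * t ≤ i + 1 := by
  have hNR : (0 : ℝ) < N := by exact_mod_cast hN
  rcases ht.2.eq_or_lt with rfl | h
  · exact ⟨N - 1, by omega, by omega, by simp, by simp⟩
  · refine ⟨⌊N * t⌋, Int.floor_nonneg.mpr (mul_nonneg hNR.le ht.1), ?_, Int.floor_le _,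
      (Int.lt_floor_add_one _).le⟩
    rw [Int.add_one_le_iff, Int.floor_lt]
    simpa using mul_lt_of_lt_one_right hNR h

theorem not_hasDerivAtWithin01_smoothValuedIsometry {t₀ : ℝ} (ht₀ : t₀ ∈ Icc (0:ℝ) 1)
    (D : Lp ℝ 1 mu01) : ¬ HasDerivAtWithin01 smoothValuedIsometry D t₀ := by
  intro hD
  obtain ⟨δ, hδ, h⟩ := hD (1 / 16) (by norm_num)
  obtain ⟨n, hn⟩ := exists_periodCount_gt (1 / δ)
  have hK : (0 : ℝ) < periodCount n := by exact_mod_cast periodCount_pos n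
  have hKδ : 1 / (periodCount n : ℝ) < δ := by
    rw [div_lt_iff₀ hδ] at hn
    rw [div_lt_iff₀ hK]
    linarith
  obtain ⟨i, hi0, hi1, hi2, hi3⟩ := exists_int_mem_Icc_unit (periodCount_pos n) ht₀
  have hi0R : (0 : ℝ) ≤ i := by exact_mod_cast hi0
  have hi1R : (i : ℝ) + 1 ≤ periodCount n := by exact_mod_cast hi1
  have key : ∀ u : ℝ, 0 ≤ u → u ≤ 1 →
      ‖smoothValuedIsometry ((i + u) / periodCount n) - smoothValuedIsometry t₀ -
        ((i + u) / periodCount n - t₀) • D‖ ≤ 1 / 16 * (1 / periodCount n) := by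
    intro u hu0 hu1
    have habs : |(i + u) / periodCount n - t₀| ≤ 1 / periodCount n := by
      rw [show (i + u) / periodCount n - t₀ = (i + u - periodCount n * t₀) / periodCount n by
        field_simp, abs_div, Nat.abs_cast]
      gcongr
      rw [abs_le]
      constructor <;> linarith
    have hmem : t₀ + ((i + u) / periodCount n - t₀) ∈ Icc (0:ℝ) 1 := by
      rw [add_sub_cancel]
      exact ⟨by positivity, (div_le_one hK).mpr (by linarith)⟩
    have := h _ hmem (habs.trans_lt hKδ)
    rw [add_sub_cancel] at this
    exact this.trans (by gcongr)
  have k0 := key 0 le_rfl zero_le_one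
  have k1 := key (1 / 2) (by norm_num) (by norm_num)
  have k2 := key 1 zero_le_one le_rfl
  rw [add_zero] at k0
  have hlow := norm_smoothValuedIsometry_second_difference n i
  set A := smoothValuedIsometry (i / periodCount n)
  set B := smoothValuedIsometry ((i + 1 / 2) / periodCount n)
  set C := smoothValuedIsometry ((i + 1) / periodCount n)
  set E := smoothValuedIsometry t₀
  have hsplit : A - (2 : ℝ) • B + C =
      (A - E - ((i : ℝ) / periodCount n - t₀) • D) -
      (2 : ℝ) • (B - E - (((i : ℝ) + 1 / 2) / periodCount n - t₀) • D) +
      (C - E - (((i : ℝ) + 1) / periodCount n - t₀) • D) := by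
    module
  have hnorm := norm_add_le
    ((A - E - ((i : ℝ) / periodCount n - t₀) • D) -
      (2 : ℝ) • (B - E - (((i : ℝ) + 1 / 2) / periodCount n - t₀) • D))
    (C - E - (((i : ℝ) + 1) / periodCount n - t₀) • D)
  have hnorm' := norm_sub_le (A - E - ((i : ℝ) / periodCount n - t₀) • D)
    ((2 : ℝ) • (B - E - (((i : ℝ) + 1 / 2) / periodCount n - t₀) • D))
  rw [norm_smul, Real.norm_ofNat] at hnorm'
  rw [hsplit] at hlow
  have hpos : 0 < 1 / (periodCount n : ℝ) := by positivity
  have heq : 1 / (2 * (periodCount n : ℝ)) = 1 / periodCount n / 2 := by ring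
  linarith

end

/-- There is an isometric embedding `F : [0,1] → L¹[0,1]` that is nowhere
differentiable, yet each `F_t` has a `C^∞` representative on `[0,1]`. -/
theorem exists_smooth_valued_nowhere_differentiable_isometry :
    ∃ F : ℝ → Lp ℝ 1 mu01,
      (∀ s ∈ Icc (0:ℝ) 1, ∀ t ∈ Icc (0:ℝ) 1, ‖F t - F s‖ = |t - s|) ∧
      (∀ t₀ ∈ Icc (0:ℝ) 1, ¬ ∃ D : Lp ℝ 1 mu01, HasDerivAtWithin01 F D t₀) ∧
      (∀ t ∈ Icc (0:ℝ) 1, ∃ g : ℝ → ℝ,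
        ContDiffOn ℝ (⊤ : ℕ∞) g (Icc (0:ℝ) 1) ∧ (F t : ℝ → ℝ) =ᵐ[mu01] g) := by
  exact ⟨smoothValuedIsometry, fun s _ t _ => norm_smoothValuedIsometry_sub s t,
    fun _ ht₀ ⟨D, hD⟩ => not_hasDerivAtWithin01_smoothValuedIsometry ht₀ D hD,
    fun t _ => ⟨smoothEmbedding t, (contDiff_smoothEmbedding t).contDiffOn,
      (integrable_mu01 (continuous_smoothEmbedding t)).coeFn_toL1⟩⟩
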